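/- Let 0 < t₁ < t₂ < π, λ ∈ ℝ, q ∈ (−1, 1), and suppose t₁*, t₂* ∈ (0, π) satisfy T_q(e^{it₁}) = e^{it₁*} and T_q(e^{it₂}) = e^{it₂*}, where T_q(z) = (z − q)/(1 − qz). Then the pullback of the rational function R_{t₁*,t₂*,λ} under T_q preserves the accessory parameter λ; that is, for every z ∈ 𝔻, R_{t₁,t₂,λ}(z) = R_{t₁*,t₂*,λ}(T_q(z)) · (T_q'(z))². -/

import Mathlib

noncomputable def ψ₁ (t₁ t₂ : ℝ) (z : ℂ) : ℂ :=
  4 * (Real.cos t₂ - Real.cos t₁) /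
    ((z ^ 2 - 2 * z * Real.cos t₁ + 1) * (z ^ 2 - 2 * z * Real.cos t₂ + 1))

noncomputable def ψ₀ (t₁ t₂ : ℝ) (z : ℂ) : ℂ :=
  (((3 * Real.cos (2 * t₁) - 5 * Real.cos (2 * t₂) + 2) / 8) * z ^ 4
    + (3 * Real.sin t₁ ^ 2 * Real.cos t₂ - 5 * Real.cos t₁ * Real.sin t₂ ^ 2) * z ^ 3
    + ((Real.cos (2 * t₁) * (11 - 2 * Real.cos (2 * t₂)) - 13 * Real.cos (2 * t₂) + 4) / 4) * z ^ 2
    + (3 * Real.sin t₁ ^ 2 * Real.cos t₂ - 5 * Real.cos t₁ * Real.sin t₂ ^ 2) * z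
    + ((3 * Real.cos (2 * t₁) - 5 * Real.cos (2 * t₂) + 2) / 8)) /
  ((z ^ 2 - 2 * z * Real.cos t₁ + 1) ^ 2 * (z ^ 2 - 2 * z * Real.cos t₂ + 1) ^ 2)

/-- The Möbius self-map `T_q(z) = (z - q)/(1 - qz)` of the unit disk. -/
noncomputable def T (q z : ℂ) : ℂ := (z - q) / (1 - q * z)

/-- The rational function `R_{t₁,t₂,λ} = 2ψ₀ - 2λψ₁`. -/
noncomputable def Rgear (t₁ t₂ lam : ℝ) (z : ℂ) : ℂ :=
  2 * ψ₀ t₁ t₂ z - 2 * lam * ψ₁ t₁ t₂ z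

theorem one_add_sq_sub_two_mul_cos_pos {t : ℝ} (q : ℝ) (ht : t ∈ Set.Ioo 0 Real.pi) :
    0 < 1 + q ^ 2 - 2 * q * Real.cos t := by
  have hs := Real.sin_pos_of_mem_Ioo ht
  nlinarith [sq_nonneg (q - Real.cos t), Real.sin_sq_add_cos_sq t, pow_pos hs 2]

theorem one_sub_mul_ne_zero {q : ℝ} (hq : q ∈ Set.Ioo (-1 : ℝ) 1) {z : ℂ} (hz : ‖z‖ ≤ 1) :
    1 - (q : ℂ) * z ≠ 0 := by
  intro h
  have h1 : ‖(q : ℂ) * z‖ = 1 := by rw [← sub_eq_zero.mp h, norm_one]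
  rw [norm_mul, Complex.norm_real, Real.norm_eq_abs] at h1
  have hq' : |q| < 1 := abs_lt.mpr hq
  nlinarith [abs_nonneg q, norm_nonneg z]

/-- The Möbius map `T q` acts on the cosine of the angle of a point of the unit circle by a
Möbius transformation. -/
theorem cos_eq_of_T_exp_eq {t s q : ℝ} (ht : t ∈ Set.Ioo 0 Real.pi)
    (hq : q ∈ Set.Ioo (-1 : ℝ) 1)
    (h : T q (Complex.exp (t * Complex.I)) = Complex.exp (s * Complex.I)) :
    Real.cos s =
      ((1 + q ^ 2) * Real.cos t - 2 * q) / (1 + q ^ 2 - 2 * q * Real.cos t) := by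
  have hne := one_sub_mul_ne_zero hq (Complex.norm_exp_ofReal_mul_I t).le
  rw [T, div_eq_iff hne] at h
  have hre := congrArg Complex.re h
  have him := congrArg Complex.im h
  simp only [Complex.sub_re, Complex.sub_im, Complex.mul_re, Complex.mul_im,
    Complex.exp_ofReal_mul_I_re, Complex.exp_ofReal_mul_I_im, Complex.ofReal_re,
    Complex.ofReal_im, Complex.one_re, Complex.one_im] at hre him
  rw [eq_div_iff (one_add_sq_sub_two_mul_cos_pos q ht).ne']
  linear_combination (-(1 - q * Real.cos t)) * hre + q * Real.sin t * him
    - (q ^ 2 * Real.cos s + q) * Real.sin_sq_add_cos_sq t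

theorem deriv_T {q z : ℂ} (h : 1 - q * z ≠ 0) :
    deriv (T q) z = (1 - q ^ 2) / (1 - q * z) ^ 2 := by
  have hn : HasDerivAt (fun w : ℂ => w - q) 1 z := (hasDerivAt_id z).sub_const q
  have hd : HasDerivAt (fun w : ℂ => 1 - q * w) (-(q * 1)) z :=
    ((hasDerivAt_id z).const_mul q).const_sub 1
  have hT : HasDerivAt (T q) _ z := hn.div hd h
  rw [hT.deriv]
  congr 1
  ring

/-- Pullback under `T q` of the quadratic polynomial with roots `exp (± i t)`, where
`c = cos t`. -/
theorem quadratic_T {c q z : ℂ} (hD : 1 + q ^ 2 - 2 * q * c ≠ 0) (hL : 1 - q * z ≠ 0) :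
    T q z ^ 2 - 2 * T q z * (((1 + q ^ 2) * c - 2 * q) / (1 + q ^ 2 - 2 * q * c)) + 1 =
      (1 - q ^ 2) ^ 2 / ((1 + q ^ 2 - 2 * q * c) * (1 - q * z) ^ 2) *
        (z ^ 2 - 2 * z * c + 1) := by
  unfold T
  generalize hDe : 1 + q ^ 2 - 2 * q * c = D at *
  generalize hLe : 1 - q * z = L at *
  field_simp
  subst hDe hLe
  ring

/-- The numerator of `ψ₀` in terms of the cosines of the two angles. -/
noncomputable def psiZeroNum (a b z : ℂ) : ℂ :=
  (3 * a ^ 2 - 5 * b ^ 2 + 2) / 4 * (z ^ 4 + 1)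
    + (3 * (1 - a ^ 2) * b - 5 * a * (1 - b ^ 2)) * (z ^ 3 + z)
    + ((2 * a ^ 2 - 1) * (13 - 4 * b ^ 2) - 26 * b ^ 2 + 17) / 4 * z ^ 2

theorem ψ₀_eq (t₁ t₂ : ℝ) (z : ℂ) :
    ψ₀ t₁ t₂ z = psiZeroNum (Real.cos t₁) (Real.cos t₂) z /
      ((z ^ 2 - 2 * z * Real.cos t₁ + 1) ^ 2 * (z ^ 2 - 2 * z * Real.cos t₂ + 1) ^ 2) := by
  simp only [ψ₀, psiZeroNum, Real.cos_two_mul]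
  congr 1
  push_cast
  simp only [Complex.sin_sq]
  ring

theorem psiZeroNum_T {a b q z : ℂ} (ha : 1 + q ^ 2 - 2 * q * a ≠ 0)
    (hb : 1 + q ^ 2 - 2 * q * b ≠ 0) (hL : 1 - q * z ≠ 0) :
    psiZeroNum (((1 + q ^ 2) * a - 2 * q) / (1 + q ^ 2 - 2 * q * a))
        (((1 + q ^ 2) * b - 2 * q) / (1 + q ^ 2 - 2 * q * b)) (T q z) =
      (1 - q ^ 2) ^ 6 * psiZeroNum a b z /
        ((1 + q ^ 2 - 2 * q * a) ^ 2 * (1 + q ^ 2 - 2 * q * b) ^ 2 * (1 - q * z) ^ 4) := by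
  unfold psiZeroNum T
  generalize hAe : 1 + q ^ 2 - 2 * q * a = A at *
  generalize hBe : 1 + q ^ 2 - 2 * q * b = B at *
  generalize hLe : 1 - q * z = L at *
  field_simp
  subst hAe hBe hLe
  ring

theorem R_pullback_preserves_accessory_parameter
    (t₁ t₂ t₁s t₂s q lam : ℝ)
    (ht₁ : 0 < t₁) (ht₁₂ : t₁ < t₂) (ht₂ : t₂ < Real.pi)
    (hq : q ∈ Set.Ioo (-1 : ℝ) 1)
    (ht₁s : t₁s ∈ Set.Ioo 0 Real.pi) (ht₂s : t₂s ∈ Set.Ioo 0 Real.pi)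
    (hT1 : T q (Complex.exp (t₁ * Complex.I)) = Complex.exp (t₁s * Complex.I))
    (hT2 : T q (Complex.exp (t₂ * Complex.I)) = Complex.exp (t₂s * Complex.I)) :
    ∀ z ∈ Metric.ball (0 : ℂ) 1,
      Rgear t₁ t₂ lam z = Rgear t₁s t₂s lam (T q z) * (deriv (T q) z) ^ 2 := by
  intro z hz
  have hL : 1 - (q : ℂ) * z ≠ 0 := one_sub_mul_ne_zero hq (mem_ball_zero_iff.mp hz).le
  have hQ : (1 : ℂ) - (q : ℂ) ^ 2 ≠ 0 := by
    have : (0 : ℝ) < 1 - q ^ 2 := by nlinarith [hq.1, hq.2]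
    exact_mod_cast this.ne'
  have h₁ : t₁ ∈ Set.Ioo 0 Real.pi := ⟨ht₁, ht₁₂.trans ht₂⟩
  have h₂ : t₂ ∈ Set.Ioo 0 Real.pi := ⟨ht₁.trans ht₁₂, ht₂⟩
  have hD₁ : 1 + (q : ℂ) ^ 2 - 2 * q * Real.cos t₁ ≠ 0 := by
    exact_mod_cast (one_add_sq_sub_two_mul_cos_pos q h₁).ne'
  have hD₂ : 1 + (q : ℂ) ^ 2 - 2 * q * Real.cos t₂ ≠ 0 := by
    exact_mod_cast (one_add_sq_sub_two_mul_cos_pos q h₂).ne'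
  have hc₁ := congrArg Complex.ofReal (cos_eq_of_T_exp_eq h₁ hq hT1)
  have hc₂ := congrArg Complex.ofReal (cos_eq_of_T_exp_eq h₂ hq hT2)
  rw [Complex.ofReal_div] at hc₁ hc₂
  simp only [Complex.ofReal_sub, Complex.ofReal_add, Complex.ofReal_mul, Complex.ofReal_pow,
    Complex.ofReal_one, Complex.ofReal_ofNat] at hc₁ hc₂
  have hψ₀ : ψ₀ t₁ t₂ z = ψ₀ t₁s t₂s (T q z) * (deriv (T q) z) ^ 2 := by
    rw [ψ₀_eq, ψ₀_eq, hc₁, hc₂, quadratic_T hD₁ hL, quadratic_T hD₂ hL,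
      psiZeroNum_T hD₁ hD₂ hL, deriv_T hL]
    generalize psiZeroNum _ _ z = N
    generalize z ^ 2 - 2 * z * (Real.cos t₁ : ℂ) + 1 = P₁
    generalize z ^ 2 - 2 * z * (Real.cos t₂ : ℂ) + 1 = P₂
    generalize 1 + (q : ℂ) ^ 2 - 2 * q * Real.cos t₁ = D₁ at *
    generalize 1 + (q : ℂ) ^ 2 - 2 * q * Real.cos t₂ = D₂ at *
    generalize 1 - (q : ℂ) * z = L at *
    generalize 1 - (q : ℂ) ^ 2 = Q at *
    field_simp
  have hψ₁ : ψ₁ t₁ t₂ z = ψ₁ t₁s t₂s (T q z) * (deriv (T q) z) ^ 2 := by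
    have hsub : (Real.cos t₂s : ℂ) - Real.cos t₁s =
        (1 - (q : ℂ) ^ 2) ^ 2 * (Real.cos t₂ - Real.cos t₁) /
          ((1 + (q : ℂ) ^ 2 - 2 * q * Real.cos t₁) *
            (1 + (q : ℂ) ^ 2 - 2 * q * Real.cos t₂)) := by
      rw [hc₁, hc₂]
      generalize hAe : 1 + (q : ℂ) ^ 2 - 2 * q * Real.cos t₁ = A at *
      generalize hBe : 1 + (q : ℂ) ^ 2 - 2 * q * Real.cos t₂ = B at *
      field_simp
      subst hAe hBe
      ring
    rw [ψ₁, ψ₁, hsub, hc₁, hc₂, quadratic_T hD₁ hL, quadratic_T hD₂ hL, deriv_T hL]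
    generalize (Real.cos t₂ : ℂ) - Real.cos t₁ = N
    generalize z ^ 2 - 2 * z * (Real.cos t₁ : ℂ) + 1 = P₁
    generalize z ^ 2 - 2 * z * (Real.cos t₂ : ℂ) + 1 = P₂
    generalize 1 + (q : ℂ) ^ 2 - 2 * q * Real.cos t₁ = D₁ at *
    generalize 1 + (q : ℂ) ^ 2 - 2 * q * Real.cos t₂ = D₂ at *
    generalize 1 - (q : ℂ) * z = L at *
    generalize 1 - (q : ℂ) ^ 2 = Q at *
    field_simp
  rw [Rgear, Rgear, hψ₀, hψ₁]
  ring
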